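/- Suppose 4·s⋆·log p ≤ n and p ≥ 3. Then with probability at least 1 − 11·exp(−n/36), simultaneously for every S ∈ 𝒮_{s⋆}: (i) λ_min(V_{n,S}) ≥ n/(216·exp(2·‖θ₀‖₂)); (ii) λ_min((1/4)·∑_{i=1}^n X_{i,S}X_{i,S}ᵀ) ≥ n/36 and λ_max((1/4)·∑_{i=1}^n X_{i,S}X_{i,S}ᵀ) ≤ 9n/4; (iii) λ_max(V_{n,S}) ≤ 9n/4; and (iv) λ_max(F_{n,θ_S}) ≤ 9n/4 for every θ_S ∈ ℝ^{|S|}. -/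

import Mathlib

open MeasureTheory ProbabilityTheory Matrix Real

/-- The law of an `n × p` matrix with i.i.d. standard normal entries. -/
noncomputable def gaussMat (n p : ℕ) : Measure (Fin n → Fin p → ℝ) :=
  Measure.pi fun _ : Fin n => Measure.pi fun _ : Fin p => gaussianReal 0 1

/-- Smallest eigenvalue (Rayleigh quotient infimum over unit vectors). -/
noncomputable def lamMin {m : Type*} [Fintype m] (A : Matrix m m ℝ) : ℝ :=
  sInf {r : ℝ | ∃ u : m → ℝ, (∑ i, u i ^ 2) = 1 ∧ r = u ⬝ᵥ A.mulVec u}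

/-- Largest eigenvalue (Rayleigh quotient supremum over unit vectors). -/
noncomputable def lamMax {m : Type*} [Fintype m] (A : Matrix m m ℝ) : ℝ :=
  sSup {r : ℝ | ∃ u : m → ℝ, (∑ i, u i ^ 2) = 1 ∧ r = u ⬝ᵥ A.mulVec u}

/-- Weighted Gram matrix `∑ᵢ wᵢ · X_{i,S} X_{i,S}ᵀ`. -/
noncomputable def gramW {n p : ℕ} (S : Finset (Fin p)) (w : Fin n → ℝ)
    (x : Fin n → Fin p → ℝ) : Matrix S S ℝ :=
  Matrix.of fun j k => ∑ i, w i * x i j.1 * x i k.1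

/-- The logistic variance function `b''(η) = exp η / (1 + exp η)²`. -/
noncomputable def logisticW (η : ℝ) : ℝ := Real.exp η / (1 + Real.exp η) ^ 2

/-- Exponential moment of the square of a standard normal variable. -/
lemma lintegral_exp_mul_sq_gaussianReal {t : ℝ} (ht : t < 1 / 2) :
    ∫⁻ y, ENNReal.ofReal (exp (t * y ^ 2)) ∂gaussianReal 0 1 =
      ENNReal.ofReal (1 / √(1 - 2 * t)) := by
  have hb : 0 < 1 / 2 - t := by linarith
  have hf : ∀ y : ℝ, gaussianPDFReal 0 1 y * exp (t * y ^ 2) =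
      (√(2 * π))⁻¹ * exp (-(1 / 2 - t) * y ^ 2) := by
    intro y
    rw [gaussianPDFReal_def]
    simp only [NNReal.coe_one, mul_one, sub_zero]
    rw [mul_assoc, ← exp_add]
    ring_nf
  rw [gaussianReal_of_var_ne_zero 0 one_ne_zero,
    lintegral_withDensity_eq_lintegral_mul _ (measurable_gaussianPDF 0 1) (by fun_prop)]
  simp only [Pi.mul_apply, gaussianPDF_def, ← ENNReal.ofReal_mul (gaussianPDFReal_nonneg _ _ _), hf]
  rw [← ofReal_integral_eq_lintegral_ofReal
    ((integrable_exp_neg_mul_sq hb).const_mul _) (.of_forall fun y => by positivity),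
    integral_const_mul, integral_gaussian, ← Real.sqrt_inv, ← Real.sqrt_mul (by positivity),
    one_div (√(1 - 2 * t)), ← Real.sqrt_inv]
  congr 2
  have : (1 - 2 * t) ≠ 0 := by linarith
  field_simp

/-- A two-sided tail bound for the standard normal distribution. -/
lemma gaussianReal_two_lt_abs_le :
    gaussianReal 0 1 {y : ℝ | 2 < |y|} ≤ ENNReal.ofReal (3 / 50) := by
  rw [gaussianReal_apply_eq_integral 0 one_ne_zero]
  apply ENNReal.ofReal_le_ofReal
  have hm : MeasurableSet {y : ℝ | 2 < |y|} := measurableSet_lt (by fun_prop) (by fun_prop)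
  have h1 : ∫ y in {y : ℝ | 2 < |y|}, gaussianPDFReal 0 1 y =
      ∫ y, (Set.Ioi (2 : ℝ)).indicator (gaussianPDFReal 0 1) |y| := by
    rw [← integral_indicator hm]
    refine integral_congr_ae (.of_forall fun y => ?_)
    by_cases h : 2 < |y|
    · dsimp only
      rw [Set.indicator_of_mem (by exact h), Set.indicator_of_mem (by exact h)]
      simp [gaussianPDFReal_def]
    · dsimp only
      rw [Set.indicator_of_notMem (by exact h), Set.indicator_of_notMem (by exact h)]
  rw [h1, integral_comp_abs, setIntegral_indicator measurableSet_Ioi]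
  have h2 : Set.Ioi (0 : ℝ) ∩ Set.Ioi 2 = Set.Ioi 2 := by
    ext y; simp only [Set.mem_inter_iff, Set.mem_Ioi]; grind
  rw [h2, ← integral_const_mul]
  have hd : ∀ y ∈ Set.Ici (2 : ℝ), HasDerivAt
      (fun y => -(√(2 * π))⁻¹ * exp (-(1 / 2) * y ^ 2))
      ((√(2 * π))⁻¹ * (y * exp (-(1 / 2) * y ^ 2))) y := by
    intro y _
    have := (((hasDerivAt_pow 2 y).const_mul (-(1 / 2 : ℝ))).exp).const_mul (-(√(2 * π))⁻¹)
    refine this.congr_deriv ?_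
    push_cast
    ring
  have hint : IntegrableOn (fun y : ℝ => (√(2 * π))⁻¹ * (y * exp (-(1 / 2) * y ^ 2)))
      (Set.Ioi 2) :=
    ((integrable_mul_exp_neg_mul_sq (by norm_num : (0 : ℝ) < 1 / 2)).const_mul _).integrableOn
  have hlim : Filter.Tendsto (fun y : ℝ => -(√(2 * π))⁻¹ * exp (-(1 / 2) * y ^ 2))
      Filter.atTop (nhds 0) := by
    have : Filter.Tendsto (fun y : ℝ => exp (-(1 / 2) * y ^ 2)) Filter.atTop (nhds 0) := by
      refine tendsto_exp_atBot.comp ?_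
      exact (Filter.tendsto_pow_atTop two_ne_zero).const_mul_atTop_of_neg (by norm_num)
    simpa using this.const_mul (-(√(2 * π))⁻¹)
  have h3 := integral_Ioi_of_hasDerivAt_of_tendsto' hd hint hlim
  calc ∫ y in Set.Ioi 2, 2 * gaussianPDFReal 0 1 y
      ≤ ∫ y in Set.Ioi 2, (√(2 * π))⁻¹ * (y * exp (-(1 / 2) * y ^ 2)) := by
        refine setIntegral_mono_on ((integrable_gaussianPDFReal 0 1).const_mul 2).integrableOn hint
          measurableSet_Ioi fun y hy => ?_
        have hy' : 2 < y := hy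
        rw [gaussianPDFReal_def]
        simp only [NNReal.coe_one, mul_one, sub_zero]
        have : -y ^ 2 / 2 = -(1 / 2) * y ^ 2 := by ring
        rw [this]
        have : 0 < (√(2 * π))⁻¹ * exp (-(1 / 2) * y ^ 2) := by positivity
        nlinarith
    _ ≤ 3 / 50 := by
        rw [h3]
        have hs : (5 / 2 : ℝ) ≤ √(2 * π) :=
          Real.le_sqrt_of_sq_le (by nlinarith [Real.pi_gt_d2])
        have he : exp (-(1 / 2) * 2 ^ 2) ≤ 3 / 20 := by
          have h : (-(1 / 2) * 2 ^ 2 : ℝ) = -(1 + 1) := by norm_num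
          rw [h, Real.exp_neg, Real.exp_add, inv_le_comm₀ (by positivity) (by norm_num)]
          nlinarith [exp_one_gt_d9]
        have hi : (√(2 * π))⁻¹ ≤ 2 / 5 := by
          rw [inv_le_comm₀ (by positivity) (by norm_num)]; linarith
        have := mul_le_mul hi he (by positivity) (by norm_num)
        linarith

/-- A unit linear combination of independent standard normal variables is standard normal. -/
lemma map_sum_mul_pi_gaussianReal {ι : Type*} [Fintype ι] {a : ι → ℝ} (ha : ∑ j, a j ^ 2 = 1) :
    (Measure.pi fun _ : ι => gaussianReal 0 1).map (fun x => ∑ j, x j * a j) =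
      gaussianReal 0 1 := by
  have hmeas : Measurable fun x : ι → ℝ => ∑ j, x j * a j := by fun_prop
  have : IsProbabilityMeasure
      ((Measure.pi fun _ : ι => gaussianReal 0 1).map (fun x => ∑ j, x j * a j)) :=
    Measure.isProbabilityMeasure_map hmeas.aemeasurable
  apply Measure.ext_of_charFun
  ext t
  rw [charFun_apply_real, integral_map hmeas.aemeasurable
    (Measurable.aestronglyMeasurable (by fun_prop)), charFun_gaussianReal]
  have h : ∀ x : ι → ℝ, Complex.exp (t * ((∑ j, x j * a j : ℝ) : ℂ) * Complex.I) =
      ∏ j, Complex.exp (((t * a j : ℝ) : ℂ) * (x j : ℂ) * Complex.I) := by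
    intro x
    rw [← Complex.exp_sum]
    congr 1
    push_cast
    rw [Finset.mul_sum, Finset.sum_mul]
    exact Finset.sum_congr rfl fun j _ => by ring
  simp_rw [h]
  rw [integral_fintype_prod_eq_prod
    (f := fun j (y : ℝ) => Complex.exp (((t * a j : ℝ) : ℂ) * (y : ℂ) * Complex.I))]
  simp_rw [← charFun_apply_real, charFun_gaussianReal]
  rw [← Complex.exp_sum]
  congr 1
  have hac : ∑ j, (a j : ℂ) ^ 2 = 1 := by exact_mod_cast ha
  push_cast
  simp only [mul_zero, zero_mul, zero_sub, one_mul]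
  rw [Finset.sum_neg_distrib, ← Finset.sum_div]
  simp_rw [mul_pow]
  rw [← Finset.mul_sum, hac, mul_one]

/-- Chernoff's bound for products of independent copies. -/
lemma pi_one_le_prod_le {α : Type*} [MeasurableSpace α] (μ : Measure α) [IsProbabilityMeasure μ]
    (n : ℕ) {G : α → ENNReal} (hG : Measurable G) {r : ENNReal} (hr : ∫⁻ a, G a ∂μ ≤ r) :
    (Measure.pi fun _ : Fin n => μ) {x | 1 ≤ ∏ i, G (x i)} ≤ r ^ n := by
  have hind : iIndepFun (fun (i : Fin n) (x : Fin n → α) => G (x i))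
      (Measure.pi fun _ : Fin n => μ) :=
    iIndepFun_pi (X := fun _ => G) fun _ => hG.aemeasurable
  have h := mul_meas_ge_le_lintegral (μ := Measure.pi fun _ : Fin n => μ)
    (f := fun x => ∏ i, G (x i)) (by fun_prop) 1
  rw [one_mul] at h
  refine h.trans ?_
  have h2 := lintegral_prod_eq_prod_lintegral_of_indepFun Finset.univ
    (fun (i : Fin n) (x : Fin n → α) => G (x i)) hind (fun i => by fun_prop)
  rw [h2]
  have h3 : ∀ i : Fin n, ∫⁻ x, G (x i) ∂(Measure.pi fun _ : Fin n => μ) = ∫⁻ a, G a ∂μ := fun i =>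
    (measurePreserving_eval (fun _ : Fin n => μ) i).lintegral_comp hG
  simp only [h3, Finset.prod_const, Finset.card_univ, Fintype.card_fin]
  gcongr

/-- If each bad outcome is witnessed by a whole ball of directions centred on the unit sphere,
Fubini's theorem turns a bound for a fixed direction into a uniform one. -/
lemma measure_le_of_ball_subset {Ω E : Type*} [MeasurableSpace Ω] (P : Measure Ω) [SFinite P]
    [NormedAddCommGroup E] [NormedSpace ℝ E] [FiniteDimensional ℝ E] [MeasureSpace E]
    [BorelSpace E] [(volume : Measure E).IsAddHaarMeasure] {ε : ℝ} (hε : 0 < ε)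
    {K : Set (Ω × E)} (hK : MeasurableSet K) {q : ENNReal} (hq : ∀ v, P {ω | (ω, v) ∈ K} ≤ q)
    {D : Set Ω} (hD : ∀ ω ∈ D, ∃ u : E, ‖u‖ = 1 ∧ ∀ v ∈ Metric.ball u ε, (ω, v) ∈ K) :
    P D ≤ ENNReal.ofReal ((1 + 1 / ε) ^ Module.finrank ℝ E) * q := by
  set d := Module.finrank ℝ E
  set V := (volume : Measure E) (Metric.ball 0 1)
  have hV0 : V ≠ 0 := (Metric.measure_ball_pos _ _ one_pos).ne'
  have hVt : V ≠ ⊤ := measure_ball_lt_top.ne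
  set K' : Set (Ω × E) := K ∩ Set.univ ×ˢ Metric.ball 0 (1 + ε)
  have hK' : MeasurableSet K' := hK.inter (MeasurableSet.univ.prod measurableSet_ball)
  have hup : (P.prod volume) K' ≤ q * (ENNReal.ofReal ((1 + ε) ^ d) * V) := by
    rw [Measure.prod_apply_symm hK', ← Measure.addHaar_ball_of_pos volume (0 : E) (by positivity)]
    calc ∫⁻ v, P ((fun ω => (ω, v)) ⁻¹' K')
        ≤ ∫⁻ v, (Metric.ball (0 : E) (1 + ε)).indicator (fun _ => q) v := by
          refine lintegral_mono fun v => ?_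
          by_cases hv : v ∈ Metric.ball (0 : E) (1 + ε)
          · rw [Set.indicator_of_mem hv]
            exact (measure_mono fun ω h => h.1).trans (hq v)
          · rw [Set.indicator_of_notMem hv]
            have : (fun ω => (ω, v)) ⁻¹' K' = ∅ :=
              Set.eq_empty_of_forall_notMem fun ω h => hv h.2.2
            simp [this]
      _ = _ := by rw [lintegral_indicator measurableSet_ball, setLIntegral_const]
  rw [Measure.prod_apply hK'] at hup
  have hlow := mul_meas_ge_le_lintegral (μ := P) (measurable_measure_prodMk_left hK' (ν := volume))
    (ENNReal.ofReal (ε ^ d) * V)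
  have hsub : D ⊆ {ω | ENNReal.ofReal (ε ^ d) * V ≤ volume (Prod.mk ω ⁻¹' K')} := by
    intro ω hω
    obtain ⟨u, hu, hb⟩ := hD ω hω
    rw [Set.mem_ofPred_eq, ← Measure.addHaar_ball_of_pos volume u hε]
    refine measure_mono fun v hv => ⟨hb v hv, trivial, ?_⟩
    rw [mem_ball_zero_iff]
    rw [mem_ball_iff_norm] at hv
    calc ‖v‖ = ‖u + (v - u)‖ := by simp
      _ ≤ ‖u‖ + ‖v - u‖ := norm_add_le _ _
      _ < 1 + ε := by linarith
  have hfin : ENNReal.ofReal (ε ^ d) * V * P D ≤ q * (ENNReal.ofReal ((1 + ε) ^ d) * V) :=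
    (mul_le_mul_right (measure_mono hsub) _).trans (hlow.trans hup)
  have hc0 : ENNReal.ofReal (ε ^ d) * V ≠ 0 :=
    mul_ne_zero (ENNReal.ofReal_pos.2 (by positivity)).ne' hV0
  have hct : ENNReal.ofReal (ε ^ d) * V ≠ ⊤ := ENNReal.mul_ne_top ENNReal.ofReal_ne_top hVt
  rw [← ENNReal.mul_le_mul_iff_right hc0 hct]
  refine hfin.trans (le_of_eq ?_)
  have : (1 + ε) ^ d = ε ^ d * (1 + 1 / ε) ^ d := by
    rw [← mul_pow]
    congr 1
    field_simp
    ring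
  rw [this, ENNReal.ofReal_mul (by positivity)]
  ring

/-- The weighted sum of squares of linear functionals. -/
noncomputable def sumSq {ι E : Type*} [Fintype ι] [AddCommGroup E] [Module ℝ E] (a : ι → ℝ)
    (L : ι → E →ₗ[ℝ] ℝ) (v : E) : ℝ := ∑ i, a i * L i v ^ 2

lemma sumSq_smul_add_smul {ι E : Type*} [Fintype ι] [AddCommGroup E] [Module ℝ E] (a : ι → ℝ)
    (L : ι → E →ₗ[ℝ] ℝ) (s t : ℝ) (u z : E) :
    sumSq a L (s • u + t • z) = s ^ 2 * sumSq a L u + 2 * s * t * ∑ i, a i * L i u * L i z +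
      t ^ 2 * sumSq a L z := by
  simp only [sumSq, map_add, map_smul, smul_eq_mul, Finset.mul_sum, ← Finset.sum_add_distrib]
  exact Finset.sum_congr rfl fun i _ => by ring

/-- A vector within `ε` of a unit vector makes an angle of sine at most `ε` with it. -/
lemma mul_norm_sq_le_inner_sq {E : Type*} [NormedAddCommGroup E] [InnerProductSpace ℝ E]
    {u v : E} {ε : ℝ} (hu : ‖u‖ = 1)
    (hε : ε < 1) (hε0 : 0 ≤ ε) (hv : v ∈ Metric.ball u ε) :
    0 < inner ℝ u v ^ 2 ∧ (1 - ε ^ 2) * ‖v‖ ^ 2 ≤ inner ℝ u v ^ 2 ∧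
      ‖v - (inner ℝ u v : ℝ) • u‖ ^ 2 = ‖v‖ ^ 2 - inner ℝ u v ^ 2 := by
  rw [mem_ball_iff_norm] at hv
  have h1 : ‖v - u‖ ^ 2 = ‖v‖ ^ 2 - 2 * inner ℝ u v + 1 := by
    rw [norm_sub_sq_real, hu, real_inner_comm]; ring
  have h2 : ‖v - u‖ ^ 2 < ε ^ 2 := by gcongr
  set c : ℝ := inner ℝ u v
  have hε2 : ε ^ 2 < 1 := by nlinarith
  have h3 : 0 < c := by nlinarith [sq_nonneg ‖v‖]
  refine ⟨by positivity, ?_, ?_⟩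
  · have h4 : ‖v‖ ^ 2 + (1 - ε ^ 2) ≤ 2 * c := by linarith
    have h5 : (‖v‖ ^ 2 + (1 - ε ^ 2)) ^ 2 ≤ (2 * c) ^ 2 :=
      pow_le_pow_left₀ (by nlinarith [sq_nonneg ‖v‖]) h4 2
    nlinarith [sq_nonneg (‖v‖ ^ 2 - (1 - ε ^ 2))]
  · rw [norm_sub_sq_real, inner_smul_right, norm_smul, hu, real_inner_comm, mul_one,
      Real.norm_eq_abs, sq_abs]
    ring

section Rayleigh

variable {ι E : Type*} [Fintype ι] [NormedAddCommGroup E] [InnerProductSpace ℝ E]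
  [FiniteDimensional ℝ E] [Nontrivial E]

/-- Spectral decomposition along a lowest eigenvector of a weighted sum of squares. -/
lemma exists_sumSq_min (a : ι → ℝ) (L : ι → E →ₗ[ℝ] ℝ) :
    ∃ u : E, ‖u‖ = 1 ∧ (∀ v, sumSq a L u * ‖v‖ ^ 2 ≤ sumSq a L v) ∧
      ∀ v, sumSq a L v = inner ℝ u v ^ 2 * sumSq a L u +
        sumSq a L (v - (inner ℝ u v : ℝ) • u) := by
  have hcont : Continuous (sumSq a L) :=
    continuous_finsetSum _ fun i _ =>
      continuous_const.mul ((L i).continuous_of_finiteDimensional.pow 2)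
  obtain ⟨u, hu, hmin⟩ := (isCompact_sphere (0 : E) 1).exists_isMinOn
    (NormedSpace.sphere_nonempty.2 zero_le_one) hcont.continuousOn
  have hu1 : ‖u‖ = 1 := by simpa using hu
  have hle : ∀ v, sumSq a L u * ‖v‖ ^ 2 ≤ sumSq a L v := by
    intro v
    rcases eq_or_ne v 0 with rfl | hv
    · simp [sumSq]
    have hv' : ‖v‖ ≠ 0 := norm_ne_zero_iff.2 hv
    have h1 : ‖v‖⁻¹ • v ∈ Metric.sphere (0 : E) 1 := by simp [norm_smul, hv']
    have h2 : sumSq a L u ≤ sumSq a L (‖v‖⁻¹ • v) := hmin h1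
    have h3 : sumSq a L (‖v‖⁻¹ • v) = (‖v‖ ^ 2)⁻¹ * sumSq a L v := by
      simpa using sumSq_smul_add_smul a L ‖v‖⁻¹ 0 v 0
    rw [h3, inv_mul_eq_div, le_div_iff₀ (by positivity)] at h2
    exact h2
  refine ⟨u, hu1, hle, fun v => ?_⟩
  set z := v - (inner ℝ u v : ℝ) • u with hz
  have huz : inner ℝ u z = 0 := by
    rw [hz, inner_sub_right, inner_smul_right, real_inner_self_eq_norm_sq, hu1]; ring
  set b := ∑ i, a i * L i u * L i z
  have hb : b = 0 := by
    have hq : ∀ t : ℝ, 0 ≤ (sumSq a L z - sumSq a L u * ‖z‖ ^ 2) * (t * t) + 2 * b * t + 0 := by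
      intro t
      have h1 := hle ((1 : ℝ) • u + t • z)
      rw [sumSq_smul_add_smul] at h1
      have h2 : ‖(1 : ℝ) • u + t • z‖ ^ 2 = 1 + t ^ 2 * ‖z‖ ^ 2 := by
        rw [norm_add_sq_real, one_smul, inner_smul_right, huz, hu1, norm_smul, mul_pow]
        simp
      rw [h2] at h1
      linarith
    have := discrim_le_zero hq
    rw [discrim] at this
    nlinarith [sq_nonneg b]
  have hv : v = (inner ℝ u v : ℝ) • u + (1 : ℝ) • z := by rw [hz]; module
  conv_lhs => rw [hv, sumSq_smul_add_smul]
  change _ + 2 * _ * 1 * b + _ = _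
  rw [hb]
  ring

/-- If a weighted sum of squares is small somewhere, then it is small on a whole ball. -/
lemma exists_ball_sumSq_lt {a : ι → ℝ} {L : ι → E →ₗ[ℝ] ℝ} {c C ε : ℝ} (ha : ∀ i, 0 ≤ a i)
    (hC : ∀ v, sumSq a L v ≤ C * ‖v‖ ^ 2) (hc : ∃ v, sumSq a L v < c * ‖v‖ ^ 2)
    (hε0 : 0 ≤ ε) (hε : ε < 1) :
    ∃ u : E, ‖u‖ = 1 ∧ ∀ v ∈ Metric.ball u ε, sumSq a L v < (c + ε ^ 2 * C) * ‖v‖ ^ 2 := by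
  obtain ⟨u, hu, hle, hdec⟩ := exists_sumSq_min a L
  refine ⟨u, hu, fun v hv => ?_⟩
  obtain ⟨hpos, hang, hnorm⟩ := mul_norm_sq_le_inner_sq hu hε hε0 hv
  obtain ⟨v₀, hv₀⟩ := hc
  have hm0 : 0 ≤ sumSq a L u := Finset.sum_nonneg fun i _ => mul_nonneg (ha i) (sq_nonneg _)
  have hmc : sumSq a L u < c := by
    by_contra! h
    nlinarith [hle v₀, sq_nonneg ‖v₀‖]
  have hC0 : 0 ≤ C := by
    have := hC u
    rw [hu] at this
    linarith
  have h1 := hC (v - (inner ℝ u v : ℝ) • u)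
  rw [hnorm] at h1
  rw [hdec v]
  set t : ℝ := inner ℝ u v ^ 2
  have h2 : t ≤ ‖v‖ ^ 2 := by nlinarith [sq_nonneg ‖v - (inner ℝ u v : ℝ) • u‖]
  nlinarith

/-- If a sum of squares is large somewhere, then it is large on a whole ball. -/
lemma exists_ball_lt_sumSq {a : ι → ℝ} {L : ι → E →ₗ[ℝ] ℝ} {C ε : ℝ} (ha : ∀ i, 0 ≤ a i)
    (hC0 : 0 ≤ C) (hC : ∃ v, C * ‖v‖ ^ 2 < sumSq a L v) (hε0 : 0 ≤ ε) (hε : ε < 1) :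
    ∃ u : E, ‖u‖ = 1 ∧ ∀ v ∈ Metric.ball u ε, (1 - ε ^ 2) * C * ‖v‖ ^ 2 < sumSq a L v := by
  obtain ⟨u, hu, hle, hdec⟩ := exists_sumSq_min (-a) L
  have hneg : ∀ v, sumSq (-a) L v = -sumSq a L v := fun v => by simp [sumSq]
  simp only [hneg] at hle hdec
  refine ⟨u, hu, fun v hv => ?_⟩
  obtain ⟨hpos, hang, -⟩ := mul_norm_sq_le_inner_sq hu hε hε0 hv
  obtain ⟨v₀, hv₀⟩ := hC
  have hMC : C < sumSq a L u := by
    by_contra! h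
    nlinarith [hle v₀, sq_nonneg ‖v₀‖]
  have h1 : 0 ≤ sumSq a L (v - (inner ℝ u v : ℝ) • u) :=
    Finset.sum_nonneg fun i _ => mul_nonneg (ha i) (sq_nonneg _)
  have := hdec v
  nlinarith

end Rayleigh

section numerics

lemma one_le_eleven_mul_exp {n : ℝ} (hn : n ≤ 86) : 1 ≤ 11 * exp (-n / 36) := by
  have h1 : exp (43 / 18 : ℝ) ≤ 11 := by
    have h : exp (43 / 18 : ℝ) = exp 1 ^ 2 * exp (7 / 18) := by
      rw [← Real.exp_nat_mul, ← Real.exp_add]; norm_num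
    have h2 : exp (7 / 18 : ℝ) ≤ 1.4763 := by
      refine (Real.exp_bound' (by norm_num) (by norm_num) (n := 5) (by norm_num)).trans ?_
      norm_num [Finset.sum_range_succ, Nat.factorial]
    have h3 : exp 1 ^ 2 ≤ 7.3891 := by nlinarith [exp_one_lt_d9, exp_pos 1]
    rw [h]
    have := mul_le_mul h3 h2 (exp_pos _).le (by norm_num)
    linarith
  have h2 : exp (-(43 / 18) : ℝ) ≤ exp (-n / 36) := exp_le_exp.2 (by linarith)
  rw [Real.exp_neg] at h2
  have h3 : (11 : ℝ)⁻¹ ≤ (exp (43 / 18 : ℝ))⁻¹ := inv_anti₀ (exp_pos _) h1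
  linarith

/-- The sparsity is a small fraction of the sample size. -/
lemma sparsity_le {n s p : ℕ} (hn : 87 ≤ n) (hs : 1 ≤ s) (hsp : s ≤ p)
    (h : 4 * (s : ℝ) * log p ≤ n) : (s : ℝ) ≤ 11 / 100 * n := by
  have hn' : (87 : ℝ) ≤ n := by exact_mod_cast hn
  rcases le_or_gt s 9 with h9 | h9
  · have : (s : ℝ) ≤ 9 := by exact_mod_cast h9
    linarith
  · have hp10 : (10 : ℝ) ≤ p := by exact_mod_cast (show 10 ≤ p by omega)
    have h1 : log 10 ≤ log p := log_le_log (by norm_num) hp10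
    have h2 : (25 / 11 : ℝ) ≤ log 10 := by
      rw [le_log_iff_exp_le (by norm_num)]
      have h : exp (25 / 11 : ℝ) = exp 1 ^ 2 * exp (3 / 11) := by
        rw [← Real.exp_nat_mul, ← Real.exp_add]; norm_num
      have h2 : exp (3 / 11 : ℝ) ≤ 1.32 := by
        refine (Real.exp_bound' (by norm_num) (by norm_num) (n := 5) (by norm_num)).trans ?_
        norm_num [Finset.sum_range_succ, Nat.factorial]
      have h3 : exp 1 ^ 2 ≤ 7.3891 := by nlinarith [exp_one_lt_d9, exp_pos 1]
      rw [h]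
      have := mul_le_mul h3 h2 (exp_pos _).le (by norm_num)
      linarith
    have hs0 : (0 : ℝ) < s := by exact_mod_cast hs
    nlinarith

/-- The union bound over supports and directions is beaten by the exponential rate `r`. -/
lemma union_rate_le {n s p : ℕ} {b r : ℝ} (hb : 1 ≤ b) (hp : 1 ≤ p)
    (h : 4 * (s : ℝ) * log p ≤ n) (hs : (s : ℝ) ≤ 11 / 100 * n)
    (hr : 1 / 4 + 11 / 100 * log b + 1 / 36 ≤ r) :
    (p : ℝ) ^ s * (b ^ s * exp (-r) ^ n) ≤ exp (-(n : ℝ) / 36) := by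
  have hp0 : (0 : ℝ) < p := by exact_mod_cast hp
  have h1 : (p : ℝ) ^ s = exp (s * log p) := by rw [Real.exp_nat_mul, exp_log hp0]
  have h2 : b ^ s = exp (s * log b) := by rw [Real.exp_nat_mul, exp_log (by linarith)]
  rw [h1, h2, ← Real.exp_nat_mul, ← Real.exp_add, ← Real.exp_add, exp_le_exp]
  have h3 : (s : ℝ) * log b ≤ 11 / 100 * n * log b :=
    mul_le_mul_of_nonneg_right hs (log_nonneg hb)
  have h4 : (n : ℝ) * (1 / 4 + 11 / 100 * log b + 1 / 36) ≤ n * r :=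
    mul_le_mul_of_nonneg_left hr (Nat.cast_nonneg n)
  linarith

lemma rate_max : exp (-1) * √3 ≤ exp (-(9 / 20)) := by
  have h1 : √3 ≤ exp (11 / 20) := by
    rw [Real.sqrt_le_left (exp_pos _).le, ← Real.exp_nat_mul]
    have : exp (((2 : ℕ) : ℝ) * (11 / 20)) = exp 1 * exp (1 / 10) := by
      rw [← Real.exp_add]; norm_num
    rw [this]
    nlinarith [exp_one_gt_d9, Real.quadratic_le_exp_of_nonneg (x := 1 / 10) (by norm_num)]
  calc exp (-1) * √3 ≤ exp (-1) * exp (11 / 20) := by gcongr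
    _ = exp (-(9 / 20)) := by rw [← Real.exp_add]; norm_num

lemma log_four_le : log 4 ≤ 1.3863 := by
  have : log 4 = 2 * log 2 := by
    rw [show (4 : ℝ) = 2 ^ 2 by norm_num, Real.log_pow]; norm_num
  rw [this]; linarith [Real.log_two_lt_d9]

lemma log_sixteen_le : log 16 ≤ 2.7726 := by
  have : log 16 = 4 * log 2 := by
    rw [show (16 : ℝ) = 2 ^ 4 by norm_num, Real.log_pow]; norm_num
  rw [this]; linarith [Real.log_two_lt_d9]

lemma rate_min : exp (7 / 2 * (1 / 9 + (1 / 15) ^ 2 * (27 / 8))) * (1 / √8) ≤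
    exp (-(59 / 100)) := by
  have h1 : exp (1.0396) ≤ √8 := by
    apply Real.le_sqrt_of_sq_le
    rw [← Real.exp_nat_mul, ← le_log_iff_exp_le (by norm_num),
      show (8 : ℝ) = 2 ^ 3 by norm_num, Real.log_pow]
    norm_num
    linarith [Real.log_two_gt_d9]
  calc _ ≤ exp (7 / 2 * (1 / 9 + (1 / 15) ^ 2 * (27 / 8))) * (1 / exp 1.0396) := by gcongr
    _ ≤ _ := by
      rw [one_div (exp 1.0396), ← Real.exp_neg, ← Real.exp_add, exp_le_exp]; norm_num

lemma rate_trunc : exp (15 / 2 * (1 / 54 + (1 / 15) ^ 2 * (27 / 8))) * (1 / √16 + 3 / 50) ≤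
    exp (-(59 / 100)) := by
  have h1 : √16 = 4 := by rw [Real.sqrt_eq_iff_mul_self_eq_of_pos] <;> norm_num
  have h2 : exp (17 / 20 : ℝ) ≤ 3.1 := by
    calc exp (17 / 20 : ℝ) ≤ exp 1 := exp_le_exp.2 (by norm_num)
      _ ≤ 3.1 := by linarith [exp_one_lt_d9]
  rw [h1]
  calc _ ≤ exp (13 / 50) * (1 / exp (17 / 20)) := by
        gcongr
        · norm_num
        · rw [le_one_div (by norm_num) (exp_pos _)]; norm_num at h2 ⊢; linarith
    _ ≤ _ := by rw [one_div, ← Real.exp_neg, ← Real.exp_add, exp_le_exp]; norm_num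

end numerics

/-- A uniform lower bound for the logistic variance function on a bounded interval. -/
lemma exp_neg_div_four_le_logisticW {η m : ℝ} (h : |η| ≤ m) :
    exp (-m) / 4 ≤ logisticW η := by
  rw [logisticW]
  obtain ⟨h1, h2⟩ := abs_le.1 h
  rw [div_le_div_iff₀ (by norm_num) (by positivity)]
  have ha : exp η * exp (-m) ≤ 1 := by
    rw [← Real.exp_add, Real.exp_le_one_iff]; linarith
  have hb : exp (-m) ≤ exp η := exp_le_exp.2 h1
  have hc : exp (-m) ≤ 1 := Real.exp_le_one_iff.2 (by linarith [abs_nonneg η])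
  nlinarith [exp_pos η, exp_pos (-m), mul_le_mul_of_nonneg_left ha (exp_pos η).le]

lemma logisticW_le (η : ℝ) : logisticW η ≤ 1 / 4 := by
  rw [logisticW]
  rw [div_le_div_iff₀ (by positivity) (by norm_num)]
  nlinarith [sq_nonneg (1 - exp η)]

/-- The linear functional on coefficient vectors supported on `T` given by a row `a`. -/
noncomputable def rowForm {p : ℕ} (T : Finset (Fin p)) (a : Fin p → ℝ) :
    EuclideanSpace ℝ T →ₗ[ℝ] ℝ where
  toFun v := ∑ j : T, a j * v j
  map_add' u v := by simp [mul_add, Finset.sum_add_distrib]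
  map_smul' c v := by
    simp only [PiLp.smul_apply, smul_eq_mul, RingHom.id_apply, Finset.mul_sum]
    exact Finset.sum_congr rfl fun j _ => by ring

lemma rowForm_apply {p : ℕ} (T : Finset (Fin p)) (a : Fin p → ℝ) (v : EuclideanSpace ℝ T) :
    rowForm T a v = ∑ j : T, a j * v j := rfl

instance (n p : ℕ) : IsProbabilityMeasure (gaussMat n p) := by
  unfold gaussMat; infer_instance

/-- A sum over a finset of a function extended by zero. -/
lemma sum_extend_zero {p : ℕ} (T : Finset (Fin p)) (f : Fin p → ℝ → ℝ) (hf : ∀ j, f j 0 = 0)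
    (v : T → ℝ) :
    ∑ j, f j (if h : j ∈ T then v ⟨j, h⟩ else 0) = ∑ j : T, f j (v j) := by
  rw [← Finset.sum_subset (Finset.subset_univ T) (fun j _ hj => by rw [dif_neg hj, hf]),
    ← Finset.sum_coe_sort T]
  exact Finset.sum_congr rfl fun j _ => by rw [dif_pos j.2]

/-- Chernoff's bound for the lower tail of a weighted quadratic form in a fixed direction. -/
lemma gaussMat_sumSq_lt_le {n p : ℕ} (T : Finset (Fin p)) {w : (Fin p → ℝ) → ℝ}
    (hw : Measurable w) {l τ r : ℝ} (hl : 0 ≤ l)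
    (h : ∀ a : Fin p → ℝ, ∑ j, a j ^ 2 = 1 →
      ∫⁻ y, ENNReal.ofReal (exp (l * (τ - w y * (∑ j, y j * a j) ^ 2)))
        ∂(Measure.pi fun _ => gaussianReal 0 1) ≤ ENNReal.ofReal r)
    (v : EuclideanSpace ℝ T) :
    gaussMat n p {x | sumSq (fun i => w (x i)) (fun i => rowForm T (x i)) v <
      τ * n * ‖v‖ ^ 2} ≤ ENNReal.ofReal r ^ n := by
  rcases eq_or_ne v 0 with rfl | hv
  · simp [sumSq]
  have hv' : 0 < ‖v‖ := norm_pos_iff.2 hv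
  set a : Fin p → ℝ := fun j => if h : j ∈ T then v ⟨j, h⟩ / ‖v‖ else 0 with ha
  have ha1 : ∑ j, a j ^ 2 = 1 := by
    rw [ha, sum_extend_zero T (fun _ t => t ^ 2) (by simp) fun j => v j / ‖v‖]
    simp_rw [div_pow]
    rw [← Finset.sum_div, ← EuclideanSpace.real_norm_sq_eq, div_self (by positivity)]
  have hrow : ∀ y : Fin p → ℝ, rowForm T y v = ‖v‖ * ∑ j, y j * a j := by
    intro y
    rw [ha, sum_extend_zero T (fun j t => y j * t) (by simp) fun j => v j / ‖v‖, rowForm_apply,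
      Finset.mul_sum]
    exact Finset.sum_congr rfl fun j _ => by field_simp
  refine (measure_mono fun x hx => ?_).trans (pi_one_le_prod_le _ n
    (G := fun y => ENNReal.ofReal (exp (l * (τ - w y * (∑ j, y j * a j) ^ 2))))
    (by fun_prop) (h a ha1))
  rw [Set.mem_ofPred_eq] at hx ⊢
  rw [← ENNReal.ofReal_prod_of_nonneg fun _ _ => (exp_pos _).le, ← Real.exp_sum,
    ← Finset.mul_sum, Finset.sum_sub_distrib]
  rw [← ENNReal.ofReal_one]
  refine ENNReal.ofReal_le_ofReal (Real.one_le_exp (mul_nonneg hl ?_))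
  have h1 : sumSq (fun i => w (x i)) (fun i => rowForm T (x i)) v =
      (∑ i, w (x i) * (∑ j, x i j * a j) ^ 2) * ‖v‖ ^ 2 := by
    rw [sumSq, Finset.sum_mul]
    exact Finset.sum_congr rfl fun i _ => by rw [hrow]; ring
  rw [h1] at hx
  have h2 := lt_of_mul_lt_mul_right hx (by positivity)
  simp only [Finset.sum_const, Finset.card_univ, Fintype.card_fin, nsmul_eq_mul]
  linarith

/-- Uniform version over directions of the Chernoff bound for quadratic forms. -/
lemma gaussMat_le_of_ball_subset {n p : ℕ} (T : Finset (Fin p)) {w : (Fin p → ℝ) → ℝ}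
    (hw : Measurable w) {l τ r ε : ℝ} (hl : 0 ≤ l) (hε : 0 < ε)
    (h : ∀ a : Fin p → ℝ, ∑ j, a j ^ 2 = 1 →
      ∫⁻ y, ENNReal.ofReal (exp (l * (τ - w y * (∑ j, y j * a j) ^ 2)))
        ∂(Measure.pi fun _ => gaussianReal 0 1) ≤ ENNReal.ofReal (exp (-r)))
    {D : Set (Fin n → Fin p → ℝ)}
    (hD : ∀ x ∈ D, ∃ u : EuclideanSpace ℝ T, ‖u‖ = 1 ∧ ∀ v ∈ Metric.ball u ε,
      sumSq (fun i => w (x i)) (fun i => rowForm T (x i)) v < τ * n * ‖v‖ ^ 2) :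
    gaussMat n p D ≤ ENNReal.ofReal ((1 + 1 / ε) ^ T.card * exp (-r) ^ n) := by
  have hK : MeasurableSet {z : (Fin n → Fin p → ℝ) × EuclideanSpace ℝ T |
      sumSq (fun i => w (z.1 i)) (fun i => rowForm T (z.1 i)) z.2 < τ * n * ‖z.2‖ ^ 2} := by
    refine measurableSet_lt ?_ (by fun_prop)
    simp only [sumSq, rowForm_apply]
    fun_prop
  have := measure_le_of_ball_subset (gaussMat n p) hε hK
    (gaussMat_sumSq_lt_le T hw hl h) hD
  rwa [finrank_euclideanSpace, Fintype.card_coe, ← ENNReal.ofReal_pow (exp_pos _).le,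
    ← ENNReal.ofReal_mul (by positivity)] at this

lemma lintegral_pi_exp_mul_sq {p : ℕ} {a : Fin p → ℝ} (ha : ∑ j, a j ^ 2 = 1) {t c : ℝ}
    (ht : t < 1 / 2) :
    ∫⁻ y, ENNReal.ofReal (exp (c + t * (∑ j, y j * a j) ^ 2))
        ∂(Measure.pi fun _ => gaussianReal 0 1) = ENNReal.ofReal (exp c * (1 / √(1 - 2 * t))) := by
  simp_rw [Real.exp_add, ENNReal.ofReal_mul (exp_pos c).le]
  have h := lintegral_map (μ := Measure.pi fun _ : Fin p => gaussianReal 0 1)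
    (f := fun y => ENNReal.ofReal (exp (t * y ^ 2))) (g := fun x => ∑ j, x j * a j)
    (by fun_prop) (by fun_prop)
  rw [map_sum_mul_pi_gaussianReal ha] at h
  rw [lintegral_const_mul _ (by fun_prop), ← lintegral_exp_mul_sq_gaussianReal ht, h]

/-- The quadratic form is rarely large. -/
lemma gaussMat_lt_sumSq_le {n p : ℕ} {T : Finset (Fin p)} (hT : T.Nonempty) :
    gaussMat n p {x | ∃ v, 27 / 8 * n * ‖v‖ ^ 2 <
      sumSq (fun _ => 1) (fun i => rowForm T (x i)) v} ≤
      ENNReal.ofReal (4 ^ T.card * exp (-(9 / 20)) ^ n) := by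
  have : Nonempty T := hT.to_subtype
  have key := gaussMat_le_of_ball_subset (n := n) T (w := fun _ => -1) (by fun_prop) (l := 1 / 3)
    (τ := -3) (r := 9 / 20) (ε := 1 / 3) (by norm_num) (by norm_num) (fun a ha => ?_)
    (D := {x | ∃ v, 27 / 8 * n * ‖v‖ ^ 2 < sumSq (fun _ => 1) (fun i => rowForm T (x i)) v})
    (fun x hx => ?_)
  · norm_num at key ⊢
    exact key
  · have h := lintegral_pi_exp_mul_sq ha (t := 1 / 3) (c := -1) (by norm_num)
    have h3 : 1 / √(1 - 2 * (1 / 3)) = √3 := by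
      rw [one_div, ← Real.sqrt_inv]; norm_num
    rw [h3] at h
    refine le_trans (le_of_eq ?_) (h.le.trans (ENNReal.ofReal_le_ofReal rate_max))
    congr! 4 with y
    ring
  · obtain ⟨u, hu, hb⟩ := exists_ball_lt_sumSq (ε := 1 / 3) (fun _ => zero_le_one) (by positivity)
      hx (by norm_num) (by norm_num)
    refine ⟨u, hu, fun v hv => ?_⟩
    have h1 := hb v hv
    simp only [sumSq, one_mul, neg_mul, Finset.sum_neg_distrib] at h1 ⊢
    linarith

/-- The quadratic form is rarely small. -/
lemma gaussMat_sumSq_one_lt_le {n p : ℕ} {T : Finset (Fin p)} (hT : T.Nonempty) :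
    gaussMat n p {x | (∀ v, sumSq (fun _ => 1) (fun i => rowForm T (x i)) v ≤
        27 / 8 * n * ‖v‖ ^ 2) ∧
      ∃ v, sumSq (fun _ => 1) (fun i => rowForm T (x i)) v < 1 / 9 * n * ‖v‖ ^ 2} ≤
      ENNReal.ofReal (16 ^ T.card * exp (-(59 / 100)) ^ n) := by
  have : Nonempty T := hT.to_subtype
  have key := gaussMat_le_of_ball_subset (n := n) T (w := fun _ => 1) (by fun_prop) (l := 7 / 2)
    (τ := 1 / 9 + (1 / 15) ^ 2 * (27 / 8)) (r := 59 / 100) (ε := 1 / 15) (by norm_num)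
    (by norm_num) (fun a ha => ?_)
    (D := {x | (∀ v, sumSq (fun _ => 1) (fun i => rowForm T (x i)) v ≤ 27 / 8 * n * ‖v‖ ^ 2) ∧
      ∃ v, sumSq (fun _ => 1) (fun i => rowForm T (x i)) v < 1 / 9 * n * ‖v‖ ^ 2})
    (fun x hx => ?_)
  · refine key.trans_eq ?_
    norm_num
  · have h := lintegral_pi_exp_mul_sq ha (t := -(7 / 2))
      (c := 7 / 2 * (1 / 9 + (1 / 15) ^ 2 * (27 / 8))) (by norm_num)
    have h3 : (1 - 2 * -(7 / 2) : ℝ) = 8 := by norm_num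
    rw [h3] at h
    refine le_trans (le_of_eq ?_) (h.le.trans (ENNReal.ofReal_le_ofReal rate_min))
    congr! 4 with y
    ring
  · obtain ⟨u, hu, hb⟩ := exists_ball_sumSq_lt (ε := 1 / 15) (fun _ => zero_le_one) hx.1
      hx.2 (by norm_num) (by norm_num)
    refine ⟨u, hu, fun v hv => ?_⟩
    have h1 := hb v hv
    linarith

/-- The indicator that the linear predictor is at most two standard deviations. -/
noncomputable def truncW {p : ℕ} (θ : Fin p → ℝ) (y : Fin p → ℝ) : ℝ :=
  if |∑ j, y j * θ j| ≤ 2 * √(∑ j, θ j ^ 2) then 1 else 0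

lemma truncW_nonneg {p : ℕ} (θ y : Fin p → ℝ) : 0 ≤ truncW θ y := by
  unfold truncW; split_ifs <;> norm_num

lemma truncW_le_one {p : ℕ} (θ y : Fin p → ℝ) : truncW θ y ≤ 1 := by
  unfold truncW; split_ifs <;> norm_num

lemma measurable_truncW {p : ℕ} (θ : Fin p → ℝ) : Measurable (truncW θ) :=
  Measurable.ite (measurableSet_le (by fun_prop) (by fun_prop)) measurable_const measurable_const

lemma pi_gaussianReal_tail_le {p : ℕ} (θ : Fin p → ℝ) :
    (Measure.pi fun _ : Fin p => gaussianReal 0 1) {y | 2 * √(∑ j, θ j ^ 2) < |∑ j, y j * θ j|} ≤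
      ENNReal.ofReal (3 / 50) := by
  set m := √(∑ j, θ j ^ 2) with hm
  have hs0 : 0 ≤ ∑ j, θ j ^ 2 := Finset.sum_nonneg fun _ _ => sq_nonneg _
  have hm0 : 0 ≤ m := Real.sqrt_nonneg _
  have hm2 : m ^ 2 = ∑ j, θ j ^ 2 := Real.sq_sqrt hs0
  rcases hm0.eq_or_lt with h0 | hpos
  · have hz : ∀ j, θ j = 0 := by
      intro j
      rw [← h0, zero_pow two_ne_zero, eq_comm,
        Finset.sum_eq_zero_iff_of_nonneg fun _ _ => sq_nonneg _] at hm2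
      simpa using hm2 j (Finset.mem_univ j)
    simp [hz, ← h0]
  · have ha : ∑ j, (θ j / m) ^ 2 = 1 := by
      simp_rw [div_pow]
      rw [← Finset.sum_div, ← hm2, div_self (by positivity)]
    refine le_trans (le_of_eq ?_) gaussianReal_two_lt_abs_le
    have h := Measure.map_apply (μ := Measure.pi fun _ : Fin p => gaussianReal 0 1)
      (f := fun x => ∑ j, x j * (θ j / m)) (by fun_prop)
      (show MeasurableSet {y : ℝ | 2 < |y|} from measurableSet_lt (by fun_prop) (by fun_prop))
    rw [map_sum_mul_pi_gaussianReal ha] at h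
    rw [h]
    congr 1
    ext y
    change _ ↔ 2 < |∑ j, y j * (θ j / m)|
    have : ∑ j, y j * (θ j / m) = (∑ j, y j * θ j) / m := by
      rw [Finset.sum_div]
      exact Finset.sum_congr rfl fun j _ => by ring
    rw [this, abs_div, abs_of_pos hpos, lt_div_iff₀ hpos]
    rfl

/-- The truncated quadratic form is rarely small. -/
lemma gaussMat_sumSq_truncW_lt_le {n p : ℕ} {T : Finset (Fin p)} (hT : T.Nonempty)
    (θ : Fin p → ℝ) :
    gaussMat n p {x | (∀ v, sumSq (fun _ => 1) (fun i => rowForm T (x i)) v ≤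
        27 / 8 * n * ‖v‖ ^ 2) ∧
      ∃ v, sumSq (fun i => truncW θ (x i)) (fun i => rowForm T (x i)) v <
        1 / 54 * n * ‖v‖ ^ 2} ≤
      ENNReal.ofReal (16 ^ T.card * exp (-(59 / 100)) ^ n) := by
  have : Nonempty T := hT.to_subtype
  have key := gaussMat_le_of_ball_subset (n := n) T (measurable_truncW θ) (l := 15 / 2)
    (τ := 1 / 54 + (1 / 15) ^ 2 * (27 / 8)) (r := 59 / 100) (ε := 1 / 15) (by norm_num)
    (by norm_num) (fun a ha => ?_)
    (D := {x | (∀ v, sumSq (fun _ => 1) (fun i => rowForm T (x i)) v ≤ 27 / 8 * n * ‖v‖ ^ 2) ∧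
      ∃ v, sumSq (fun i => truncW θ (x i)) (fun i => rowForm T (x i)) v <
        1 / 54 * n * ‖v‖ ^ 2})
    (fun x hx => ?_)
  · refine key.trans_eq ?_
    norm_num
  · set c : ℝ := 15 / 2 * (1 / 54 + (1 / 15) ^ 2 * (27 / 8)) with hc
    have h := lintegral_pi_exp_mul_sq ha (t := -(15 / 2)) (c := c) (by norm_num)
    have h3 : (1 - 2 * -(15 / 2) : ℝ) = 16 := by norm_num
    rw [h3] at h
    set A : Set (Fin p → ℝ) := {y | 2 * √(∑ j, θ j ^ 2) < |∑ j, y j * θ j|}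
    have hA : MeasurableSet A := measurableSet_lt (by fun_prop) (by fun_prop)
    calc _ ≤ ∫⁻ y, (ENNReal.ofReal (exp (c + -(15 / 2) * (∑ j, y j * a j) ^ 2)) +
            A.indicator (fun _ => ENNReal.ofReal (exp c)) y)
            ∂(Measure.pi fun _ => gaussianReal 0 1) := by
          refine lintegral_mono fun y => ?_
          by_cases hy : y ∈ A
          · have hw : truncW θ y = 0 := if_neg (not_le.2 hy)
            rw [Set.indicator_of_mem hy, hw, zero_mul, sub_zero]
            exact le_add_self
          · have hw : truncW θ y = 1 := if_pos (not_lt.1 hy)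
            rw [Set.indicator_of_notMem hy, hw, add_zero]
            refine le_of_eq ?_
            congr 2
            ring
      _ ≤ ENNReal.ofReal (exp c * (1 / √16)) +
            ENNReal.ofReal (exp c) * ENNReal.ofReal (3 / 50) := by
          rw [lintegral_add_left (by fun_prop), h, lintegral_indicator hA, setLIntegral_const]
          gcongr
          exact pi_gaussianReal_tail_le θ
      _ ≤ _ := by
          rw [← ENNReal.ofReal_mul (exp_pos _).le, ← ENNReal.ofReal_add (by positivity)
            (by positivity), ← mul_add]
          exact ENNReal.ofReal_le_ofReal rate_trunc
  · have hle : ∀ v, sumSq (fun i => truncW θ (x i)) (fun i => rowForm T (x i)) v ≤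
        27 / 8 * n * ‖v‖ ^ 2 := fun v => (Finset.sum_le_sum fun i _ =>
      mul_le_mul_of_nonneg_right (truncW_le_one _ _) (sq_nonneg _)).trans (hx.1 v)
    obtain ⟨u, hu, hb⟩ := exists_ball_sumSq_lt (ε := 1 / 15)
      (fun i => truncW_nonneg _ _) hle hx.2 (by norm_num) (by norm_num)
    refine ⟨u, hu, fun v hv => ?_⟩
    have h1 := hb v hv
    linarith

/-- Union bound over all supports of a given size. -/
lemma gaussMat_iUnion_le {n p s : ℕ} {b r : ℝ} (hb : 1 ≤ b) (hp : 1 ≤ p)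
    (h : 4 * (s : ℝ) * log p ≤ n) (hs : (s : ℝ) ≤ 11 / 100 * n)
    (hr : 1 / 4 + 11 / 100 * log b + 1 / 36 ≤ r)
    {B : Finset (Fin p) → Set (Fin n → Fin p → ℝ)}
    (hB : ∀ T, T.card = s → gaussMat n p (B T) ≤ ENNReal.ofReal (b ^ T.card * exp (-r) ^ n)) :
    gaussMat n p (⋃ T ∈ Finset.powersetCard s Finset.univ, B T) ≤
      ENNReal.ofReal (exp (-(n : ℝ) / 36)) := by
  have hb0 : 0 ≤ b := zero_le_one.trans hb
  refine (measure_biUnion_finset_le _ _).trans ?_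
  calc ∑ T ∈ Finset.powersetCard s Finset.univ, gaussMat n p (B T)
      ≤ ∑ _T ∈ Finset.powersetCard s (Finset.univ : Finset (Fin p)),
          ENNReal.ofReal (b ^ s * exp (-r) ^ n) := by
        refine Finset.sum_le_sum fun T hT => ?_
        have hc := (Finset.mem_powersetCard.1 hT).2
        simpa only [hc] using hB T hc
    _ = ENNReal.ofReal ((p.choose s : ℝ) * (b ^ s * exp (-r) ^ n)) := by
        rw [Finset.sum_const, Finset.card_powersetCard, Finset.card_univ, Fintype.card_fin,
          nsmul_eq_mul, ENNReal.ofReal_mul (Nat.cast_nonneg _), ENNReal.ofReal_natCast]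
    _ ≤ _ := by
        refine ENNReal.ofReal_le_ofReal (le_trans ?_ (union_rate_le hb hp h hs hr))
        gcongr
        exact_mod_cast Nat.choose_le_pow p s

lemma dotProduct_gramW_mulVec {n p : ℕ} (S : Finset (Fin p)) (w : Fin n → ℝ)
    (x : Fin n → Fin p → ℝ) (u : S → ℝ) :
    u ⬝ᵥ (gramW S w x).mulVec u = ∑ i, w i * (∑ j : S, x i j * u j) ^ 2 := by
  simp only [dotProduct, mulVec, gramW, Matrix.of_apply, Finset.mul_sum, Finset.sum_mul]
  simp_rw [sq, Finset.sum_mul_sum, Finset.mul_sum]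
  rw [Finset.sum_comm' (t' := Finset.univ) (s' := fun _ => Finset.univ) (by simp)]
  conv_lhs => enter [2, k]; rw [Finset.sum_comm]
  rw [Finset.sum_comm]
  refine Finset.sum_congr rfl fun i _ => Finset.sum_congr rfl fun j _ =>
    Finset.sum_congr rfl fun k _ => by ring

lemma le_lamMin_gramW {n p : ℕ} {S : Finset (Fin p)} (hS : S.Nonempty) {w : Fin n → ℝ}
    {x : Fin n → Fin p → ℝ} {c : ℝ}
    (h : ∀ u : S → ℝ, ∑ j, u j ^ 2 = 1 → c ≤ ∑ i, w i * (∑ j : S, x i j * u j) ^ 2) :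
    c ≤ lamMin (gramW S w x) := by
  classical
  obtain ⟨j₀, hj₀⟩ := hS
  refine le_csInf ⟨_, Pi.single (⟨j₀, hj₀⟩ : S) 1, ?_, rfl⟩ ?_
  · rw [Finset.sum_eq_single (⟨j₀, hj₀⟩ : S)] <;> simp +contextual
  · rintro _ ⟨u, hu, rfl⟩
    rw [dotProduct_gramW_mulVec]
    exact h u hu

lemma lamMax_gramW_le {n p : ℕ} {S : Finset (Fin p)} {w : Fin n → ℝ}
    {x : Fin n → Fin p → ℝ} {c : ℝ} (hc : 0 ≤ c)
    (h : ∀ u : S → ℝ, ∑ j, u j ^ 2 = 1 → ∑ i, w i * (∑ j : S, x i j * u j) ^ 2 ≤ c) :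
    lamMax (gramW S w x) ≤ c := by
  refine Real.sSup_le ?_ hc
  rintro _ ⟨u, hu, rfl⟩
  rw [dotProduct_gramW_mulVec]
  exact h u hu

/-- A coefficient vector supported on `S` is also one supported on a larger set. -/
lemma exists_rowForm_eq {p : ℕ} {S T : Finset (Fin p)} (hST : S ⊆ T) (u : S → ℝ) :
    ∃ v : EuclideanSpace ℝ T, ‖v‖ ^ 2 = ∑ j, u j ^ 2 ∧
      ∀ a, rowForm T a v = ∑ j : S, a j * u j := by
  have key : ∀ f : Fin p → ℝ → ℝ, (∀ j, f j 0 = 0) →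
      ∑ j : T, f j (if h : j.1 ∈ S then u ⟨j, h⟩ else 0) = ∑ j : S, f j (u j) := by
    intro f hf
    rw [Finset.sum_coe_sort T fun j => f j (if h : j ∈ S then u ⟨j, h⟩ else 0),
      Finset.sum_subset (Finset.subset_univ T), sum_extend_zero S f hf]
    intro j _ hj
    rw [dif_neg fun h => hj (hST h), hf]
  refine ⟨WithLp.toLp 2 fun j => if h : j.1 ∈ S then u ⟨j, h⟩ else 0, ?_, fun a => ?_⟩
  · rw [EuclideanSpace.real_norm_sq_eq]
    exact key (fun _ t => t ^ 2) (by simp)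
  · rw [rowForm_apply]
    exact key (fun j t => a j * t) (by simp)

/-- All quadratic forms over supports of size `s` are well conditioned with high probability. -/
lemma gaussMat_ill_conditioned_le {n p s : ℕ} (hn : 87 ≤ n) (hs : 1 ≤ s) (hsp : s ≤ p)
    (h : 4 * (s : ℝ) * log p ≤ n) (θ : Fin p → ℝ) :
    gaussMat n p {x | ∃ T : Finset (Fin p), T.card = s ∧
      ¬ ((∀ v, sumSq (fun _ => 1) (fun i => rowForm T (x i)) v ≤ 27 / 8 * n * ‖v‖ ^ 2) ∧
        (∀ v, 1 / 9 * n * ‖v‖ ^ 2 ≤ sumSq (fun _ => 1) (fun i => rowForm T (x i)) v) ∧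
        ∀ v, 1 / 54 * n * ‖v‖ ^ 2 ≤
          sumSq (fun i => truncW θ (x i)) (fun i => rowForm T (x i)) v)} ≤
      ENNReal.ofReal (11 * exp (-(n : ℝ) / 36)) := by
  have hsn := sparsity_le hn hs hsp h
  have hp : 1 ≤ p := hs.trans hsp
  have hne : ∀ T : Finset (Fin p), T.card = s → T.Nonempty := fun T hT =>
    Finset.card_pos.1 (by omega)
  have h1 := gaussMat_iUnion_le (b := 4) (by norm_num) hp h hsn
    (by linarith [log_four_le]) fun T hT => gaussMat_lt_sumSq_le (n := n) (hne T hT)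
  have h2 := gaussMat_iUnion_le (b := 16) (by norm_num) hp h hsn
    (by linarith [log_sixteen_le]) fun T hT => gaussMat_sumSq_one_lt_le (n := n) (hne T hT)
  have h3 := gaussMat_iUnion_le (b := 16) (by norm_num) hp h hsn
    (by linarith [log_sixteen_le]) fun T hT =>
      gaussMat_sumSq_truncW_lt_le (n := n) (hne T hT) θ
  refine (measure_mono ?_).trans ((measure_union_le _ _).trans
    ((add_le_add h1 ((measure_union_le _ _).trans (add_le_add h2 h3))).trans ?_))
  · rintro x ⟨T, hT, hbad⟩
    simp only [Set.mem_union, Set.mem_iUnion, Finset.mem_powersetCard, Set.mem_ofPred_eq]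
    have hT' : T ⊆ Finset.univ ∧ T.card = s := ⟨Finset.subset_univ T, hT⟩
    by_cases hmax : ∀ v, sumSq (fun _ => 1) (fun i => rowForm T (x i)) v ≤ 27 / 8 * n * ‖v‖ ^ 2
    · right
      by_cases hmin : ∀ v, 1 / 9 * n * ‖v‖ ^ 2 ≤ sumSq (fun _ => 1) (fun i => rowForm T (x i)) v
      · right
        refine ⟨T, hT', hmax, ?_⟩
        by_contra! htr
        exact hbad ⟨hmax, hmin, htr⟩
      · left
        push Not at hmin
        exact ⟨T, hT', hmax, hmin⟩
    · left
      push Not at hmax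
      exact ⟨T, hT', hmax⟩
  · rw [← ENNReal.ofReal_add (by positivity) (by positivity),
      ← ENNReal.ofReal_add (by positivity) (by positivity)]
    exact ENNReal.ofReal_le_ofReal (by linarith [exp_pos (-(n : ℝ) / 36)])

/-- The logistic weight dominates a multiple of the truncation indicator. -/
lemma mul_truncW_le_logisticW {p : ℕ} (θ y : Fin p → ℝ) :
    exp (-(2 * √(∑ j, θ j ^ 2))) / 4 * truncW θ y ≤ logisticW (∑ j, y j * θ j) := by
  unfold truncW
  split_ifs with h
  · rw [mul_one]
    exact exp_neg_div_four_le_logisticW h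
  · rw [mul_zero, logisticW]
    positivity

theorem stmt_17 (n p sstar : ℕ) (hn : 1 ≤ n) (hs : 1 ≤ sstar) (hsp : sstar ≤ p)
    (hp : 3 ≤ p) (hsample : 4 * (sstar : ℝ) * Real.log p ≤ (n : ℝ))
    (θ₀ : Fin p → ℝ) :
    1 - ENNReal.ofReal (11 * Real.exp (-(n : ℝ) / 36)) ≤
      gaussMat n p {x | ∀ S : Finset (Fin p), S.Nonempty → S.card ≤ sstar →
        ((n : ℝ) / (216 * Real.exp (2 * Real.sqrt (∑ j, θ₀ j ^ 2)))
            ≤ lamMin (gramW S (fun i => logisticW (∑ j, x i j * θ₀ j)) x)) ∧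
        ((n : ℝ) / 36 ≤ lamMin (gramW S (fun _ => (1 : ℝ) / 4) x)) ∧
        (lamMax (gramW S (fun _ => (1 : ℝ) / 4) x) ≤ 9 * (n : ℝ) / 4) ∧
        (lamMax (gramW S (fun i => logisticW (∑ j, x i j * θ₀ j)) x) ≤ 9 * (n : ℝ) / 4) ∧
        (∀ θs : S → ℝ,
          lamMax (gramW S (fun i => logisticW (∑ j : S, x i j.1 * θs j)) x)
            ≤ 9 * (n : ℝ) / 4)} := by
  rcases le_or_gt n 86 with h86 | h87
  · have h := one_le_eleven_mul_exp (n := n) (by exact_mod_cast h86)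
    rw [tsub_eq_zero_of_le (ENNReal.one_le_ofReal.2 h)]
    exact zero_le
  rw [tsub_le_iff_right, ← measure_univ (μ := gaussMat n p)]
  refine le_trans ?_ (add_le_add_right (gaussMat_ill_conditioned_le h87 hs hsp hsample θ₀) _)
  refine (measure_mono fun x _ => ?_).trans (measure_union_le _ _)
  rw [Set.mem_union, or_iff_not_imp_right]
  intro hx S hS hSc
  obtain ⟨T, hST, -, hT⟩ := Finset.exists_subsuperset_card_eq (Finset.subset_univ S) hSc
    (by simpa using hsp)
  have hgood := fun h => hx ⟨T, hT, h⟩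
  rw [imp_false, not_not] at hgood
  obtain ⟨hmax, hmin, htr⟩ := hgood
  have hn0 : (0 : ℝ) ≤ n := Nat.cast_nonneg n
  have hform : ∀ u : S → ℝ, ∑ j, u j ^ 2 = 1 →
      ∑ i, (∑ j : S, x i j * u j) ^ 2 ≤ 27 / 8 * n ∧
      1 / 9 * n ≤ ∑ i, (∑ j : S, x i j * u j) ^ 2 ∧
      1 / 54 * n ≤ ∑ i, truncW θ₀ (x i) * (∑ j : S, x i j * u j) ^ 2 := by
    intro u hu
    obtain ⟨v, hv, hrow⟩ := exists_rowForm_eq hST u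
    have h1 := hmax v
    have h2 := hmin v
    have h3 := htr v
    simp only [sumSq, hrow, hv, hu, one_mul, mul_one] at h1 h2 h3
    exact ⟨h1, h2, h3⟩
  have hle : ∀ w : Fin n → ℝ, (∀ i, w i ≤ 1 / 4) → lamMax (gramW S w x) ≤ 9 * (n : ℝ) / 4 := by
    intro w hw
    refine lamMax_gramW_le (by positivity) fun u hu => ?_
    calc ∑ i, w i * (∑ j : S, x i j * u j) ^ 2
        ≤ ∑ i, 1 / 4 * (∑ j : S, x i j * u j) ^ 2 := by gcongr with i _; exact hw i
      _ ≤ 9 * (n : ℝ) / 4 := by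
        rw [← Finset.mul_sum]
        linarith [(hform u hu).1]
  refine ⟨le_lamMin_gramW hS fun u hu => ?_, le_lamMin_gramW hS fun u hu => ?_,
    hle _ fun _ => le_rfl, hle _ fun _ => logisticW_le _, fun θs => hle _ fun _ => logisticW_le _⟩
  · set m := √(∑ j, θ₀ j ^ 2)
    calc (n : ℝ) / (216 * exp (2 * m)) = exp (-(2 * m)) / 4 * (1 / 54 * n) := by
          rw [Real.exp_neg]
          field_simp
          norm_num
      _ ≤ exp (-(2 * m)) / 4 * ∑ i, truncW θ₀ (x i) * (∑ j : S, x i j * u j) ^ 2 := by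
          gcongr
          exact (hform u hu).2.2
      _ ≤ _ := by
          rw [Finset.mul_sum]
          refine Finset.sum_le_sum fun i _ => ?_
          rw [← mul_assoc]
          exact mul_le_mul_of_nonneg_right (mul_truncW_le_logisticW θ₀ (x i)) (sq_nonneg _)
  · rw [← Finset.mul_sum]
    linarith [(hform u hu).2.1]
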